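/- Let {a_n}_{n≥1} be a nonnegative real sequence such that the sine series ∑_{n=1}^∞ a_n sin(nx) converges pointwise on ℝ to a function f that is continuous (and 2π-periodic). Then the partial sums S_n(f,x) = ∑_{k=1}^n a_k sin(kx) converge uniformly to f, i.e., lim_{n→∞} sup_x |f(x) − S_n(f,x)| = 0. -/

import Mathlib

open Filter Topology

lemma schwarz_le (F f : ℝ → ℝ) (hF : Continuous F)
    (hD : ∀ x, Tendsto (fun h : ℝ => (F (x+h) + F (x-h) - 2 * F x) / h^2) (𝓝[>] 0) (𝓝 (f x)))
    (x h M : ℝ) (hh : 0 < h) (hM : ∀ t, |t - x| ≤ h → f t ≤ M) :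
    F (x+h) + F (x-h) - 2 * F x ≤ M * h^2 := by
  by_contra! hcon
  set m := (F (x+h) + F (x-h) - 2 * F x) / h^2 with hm
  set c := (F (x+h) - F (x-h)) / (2*h) with hc
  have hmM : M < m := by rw [hm, lt_div_iff₀ (by positivity)]; exact hcon
  set G : ℝ → ℝ := fun t => F t - (F x + c * (t-x) + m/2 * (t-x)^2) with hG
  have hGc : Continuous G := by simp only [hG]; fun_prop
  have G0 : G x = 0 := by simp [hG]
  have G1 : G (x+h) = 0 := by simp only [hG, hm, hc]; field_simp; ring
  have G2 : G (x-h) = 0 := by simp only [hG, hm, hc]; field_simp; ring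
  have key : ∃ t ∈ Set.Ioo (x-h) (x+h), ∀ s ∈ Set.Icc (x-h) (x+h), G t ≤ G s := by
    obtain ⟨t, ht, hmin⟩ := (isCompact_Icc (a := x-h) (b := x+h)).exists_isMinOn
      ⟨x, by constructor <;> linarith⟩ hGc.continuousOn
    by_cases h1 : t = x - h
    · exact ⟨x, ⟨by linarith, by linarith⟩, fun s hs => by
        have := hmin hs; simp only [Set.mem_ofPred_eq] at this; rw [h1, G2] at this; linarith⟩
    by_cases h2 : t = x + h
    · exact ⟨x, ⟨by linarith, by linarith⟩, fun s hs => by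
        have := hmin hs; simp only [Set.mem_ofPred_eq] at this; rw [h2, G1] at this; linarith⟩
    · exact ⟨t, ⟨lt_of_le_of_ne ht.1 (Ne.symm h1), lt_of_le_of_ne ht.2 h2⟩, fun s hs => hmin hs⟩
  obtain ⟨t, ht, hmin⟩ := key
  have : m ≤ f t := by
    refine ge_of_tendsto (hD t) ?_
    have hd : 0 < min (t - (x-h)) (x+h-t) := lt_min (by linarith [ht.1]) (by linarith [ht.2])
    filter_upwards [Ioo_mem_nhdsGT hd] with s hs
    have hs1 := lt_of_lt_of_le hs.2 (min_le_left _ _)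
    have hs2 := lt_of_lt_of_le hs.2 (min_le_right _ _)
    have hs0 := hs.1
    rw [le_div_iff₀ (by positivity)]
    have e1 := hmin (t+s) ⟨by linarith, by linarith⟩
    have e2 := hmin (t-s) ⟨by linarith, by linarith⟩
    simp only [hG] at e1 e2
    nlinarith
  have := hM t (by rw [abs_le]; constructor <;> linarith [ht.1, ht.2])
  linarith

lemma schwarz_abs (F f : ℝ → ℝ) (hF : Continuous F)
    (hD : ∀ x, Tendsto (fun h : ℝ => (F (x+h) + F (x-h) - 2 * F x) / h^2) (𝓝[>] 0) (𝓝 (f x)))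
    (x h e : ℝ) (hh : 0 < h) (hM : ∀ t, |t - x| ≤ h → |f t - f x| ≤ e) :
    |F (x+h) + F (x-h) - 2 * F x - f x * h^2| ≤ e * h^2 := by
  have h1 := schwarz_le F f hF hD x h (f x + e) hh
    (fun t ht => by linarith [(abs_le.1 (hM t ht)).2])
  have h2 := schwarz_le (fun t => - F t) (fun t => - f t) hF.neg
    (fun x => by
      refine (hD x).neg.congr fun h => ?_
      ring) x h (- f x + e) hh
    (fun t ht => by linarith [(abs_le.1 (hM t ht)).1])
  rw [abs_le]; constructor <;> nlinarith

lemma phi_bound (u : ℝ) (hu : 0 < u) :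
    |2 * Real.sin u * (u * Real.cos u - Real.sin u) / u^3| ≤ 8 * (1 / (1 + u^2)) := by
  have s1 := Real.sin_gt_sub_cube hu
  have s2 := Real.sin_lt hu
  have c1 := Real.one_sub_sq_div_two_le_cos (x := u)
  have c2 := Real.cos_le_one u
  have c3 := Real.neg_one_le_cos u
  have s3 := Real.sin_le_one u
  have s4 := Real.neg_one_le_sin u
  have hs := Real.abs_sin_le_abs (x := u)
  rw [abs_of_pos hu] at hs
  have hs' := Real.abs_sin_le_one u
  rw [abs_div, abs_mul, abs_mul, abs_two, abs_of_pos (show 0 < u^3 by positivity), mul_one_div,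
    div_le_div_iff₀ (by positivity) (by positivity)]
  rcases le_total u 1 with h | h
  · have hb : |u * Real.cos u - Real.sin u| ≤ u^3 := by
      rw [abs_le]; constructor <;> nlinarith [pow_pos hu 3]
    have : |Real.sin u| * |u * Real.cos u - Real.sin u| ≤ 1 * u^3 := by gcongr
    have h2 : u^2 ≤ 1 := by nlinarith
    have h3 := pow_pos hu 3
    nlinarith
  · have hb : |u * Real.cos u - Real.sin u| ≤ 2 * u := by
      rw [abs_le]; constructor <;> nlinarith
    have : |Real.sin u| * |u * Real.cos u - Real.sin u| ≤ 1 * (2*u) := by gcongr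
    have h2 : 1 ≤ u^2 := by nlinarith
    have h3 : 2 * |Real.sin u| * |u * Real.cos u - Real.sin u| * (1+u^2) ≤ 2 * (2*u) * (1 + u^2) := by
      gcongr ?_ * _; linarith
    nlinarith

lemma phi_var (u v : ℝ) (hu : 0 ≤ u) (huv : u ≤ v) :
    |Real.sinc v ^ 2 - Real.sinc u ^ 2| ≤ 8 * (Real.arctan v - Real.arctan u) := by
  have hd : ∀ x : ℝ, 0 < x → HasDerivAt (fun t => Real.sinc t ^ 2)
      (2 * Real.sin x * (x * Real.cos x - Real.sin x) / x^3) x := by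
    intro x hx
    have h1 : HasDerivAt (fun t => (Real.sin t / t)^2)
      (2 * Real.sin x * (x * Real.cos x - Real.sin x) / x^3) x := by
      have := ((Real.hasDerivAt_sin x).div (hasDerivAt_id x) hx.ne').pow 2
      refine this.congr_deriv ?_
      simp; field_simp
    refine h1.congr_of_eventuallyEq ?_
    filter_upwards [lt_mem_nhds hx] with t ht
    rw [Real.sinc_of_ne_zero ht.ne']
  have ha := fun x : ℝ => (Real.hasDerivAt_arctan x).const_mul 8
  have cs := Real.continuous_sinc
  have m1 : MonotoneOn (fun t => 8 * Real.arctan t + Real.sinc t ^ 2) (Set.Ici 0) := by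
    apply monotoneOn_of_deriv_nonneg (convex_Ici 0)
    · exact Continuous.continuousOn (by fun_prop)
    · intro x hx
      rw [interior_Ici] at hx
      exact ((ha x).add (hd x hx)).differentiableAt.differentiableWithinAt
    · intro x hx
      rw [interior_Ici] at hx
      have := ((ha x).add (hd x hx)).deriv
      change deriv (fun t => 8 * Real.arctan t + Real.sinc t ^ 2) x = _ at this
      rw [this]
      linarith [(abs_le.1 (phi_bound x hx)).1]
  have m2 : MonotoneOn (fun t => 8 * Real.arctan t - Real.sinc t ^ 2) (Set.Ici 0) := by
    apply monotoneOn_of_deriv_nonneg (convex_Ici 0)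
    · exact Continuous.continuousOn (by fun_prop)
    · intro x hx
      rw [interior_Ici] at hx
      exact ((ha x).sub (hd x hx)).differentiableAt.differentiableWithinAt
    · intro x hx
      rw [interior_Ici] at hx
      have := ((ha x).sub (hd x hx)).deriv
      change deriv (fun t => 8 * Real.arctan t - Real.sinc t ^ 2) x = _ at this
      rw [this]
      linarith [(abs_le.1 (phi_bound x hx)).2]
  have e1 := m1 hu (hu.trans huv : v ∈ Set.Ici 0) huv
  have e2 := m2 hu (hu.trans huv : v ∈ Set.Ici 0) huv
  simp only at e1 e2
  rw [abs_le]; constructor <;> linarith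

/-- Riemann's first theorem (quantitative, finite form). -/
lemma riemann_fin (b : ℕ → ℝ) (s e B h : ℝ) (K : ℕ) (he : 0 ≤ e) (hB : 0 ≤ B) (hh : 0 < h)
    (h1 : ∀ n, |s - ∑ k ∈ Finset.range (n+1), b k| ≤ e + B)
    (h2 : ∀ n, K ≤ n → |s - ∑ k ∈ Finset.range (n+1), b k| ≤ e) (N : ℕ) :
    |∑ k ∈ Finset.range (N+1), b k * Real.sinc (k*h)^2
      + (s - ∑ k ∈ Finset.range (N+1), b k) * Real.sinc (N*h)^2 - s| ≤
      8 * e * Real.arctan (N*h) + 8 * B * Real.arctan ((min N K : ℕ) * h) := by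
  induction N with
  | zero => simp
  | succ N ih =>
    rw [Finset.sum_range_succ _ (N+1), Finset.sum_range_succ b (N+1)]
    set P := ∑ k ∈ Finset.range (N+1), b k * Real.sinc (k*h)^2
    set r := s - ∑ k ∈ Finset.range (N+1), b k with hr
    have hv := phi_var (N*h) ((N+1:ℕ)*h) (by positivity) (by push_cast; nlinarith)
    have hA : 0 ≤ Real.arctan ((N+1:ℕ)*h) - Real.arctan (N*h) := by
      have := abs_nonneg (Real.sinc ((N+1:ℕ)*h)^2 - Real.sinc (N*h)^2)
      linarith
    have e1 : P + b (N+1) * Real.sinc ((N+1:ℕ)*h)^2 +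
        (s - (∑ k ∈ Finset.range (N+1), b k + b (N+1))) * Real.sinc ((N+1:ℕ)*h)^2 - s
        = (P + r * Real.sinc (N*h)^2 - s) + r * (Real.sinc ((N+1:ℕ)*h)^2 - Real.sinc (N*h)^2) := by
      rw [hr]; ring
    rw [e1]
    refine (abs_add_le _ _).trans ?_
    rw [abs_mul]
    rcases lt_or_ge N K with hK | hK
    · rw [min_eq_left (by omega)]
      rw [min_eq_left (by omega)] at ih
      have : |r| * |Real.sinc ((N+1:ℕ)*h)^2 - Real.sinc (N*h)^2| ≤
        (e + B) * (8 * (Real.arctan ((N+1:ℕ)*h) - Real.arctan (N*h))) := by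
        gcongr; exact h1 N
      linarith
    · rw [min_eq_right (by omega)]
      rw [min_eq_right (by omega)] at ih
      have : |r| * |Real.sinc ((N+1:ℕ)*h)^2 - Real.sinc (N*h)^2| ≤
        e * (8 * (Real.arctan ((N+1:ℕ)*h) - Real.arctan (N*h))) := by
        gcongr; exact h2 N hK
      linarith

lemma sinc_sq_le (u : ℝ) (hu : u ≠ 0) : Real.sinc u ^ 2 ≤ 1 / u ^ 2 := by
  rw [Real.sinc_of_ne_zero hu, div_pow]
  gcongr
  have := Real.sin_sq_add_cos_sq u
  nlinarith [sq_nonneg (Real.cos u)]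

lemma sinc_sq_le_one (u : ℝ) : Real.sinc u ^ 2 ≤ 1 := by
  have := Real.abs_sinc_le_one u
  rw [← sq_abs]
  exact pow_le_one₀ (abs_nonneg _) this

lemma term_bound (b : ℕ → ℝ) (C : ℝ) (hb0 : b 0 = 0) (hb : ∀ n, |b n| ≤ C) (h : ℝ) (hh : 0 < h)
    (k : ℕ) : ‖b k * Real.sinc (k*h)^2‖ ≤ C / h^2 * (1 / (k:ℝ)^2) := by
  have hC : 0 ≤ C := (abs_nonneg _).trans (hb 0)
  rcases Nat.eq_zero_or_pos k with rfl | hk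
  · simp [hb0]
  · have hk' : (0:ℝ) < k := by exact_mod_cast hk
    rw [Real.norm_eq_abs, abs_mul, abs_of_nonneg (sq_nonneg (Real.sinc _))]
    calc |b k| * Real.sinc (k*h)^2 ≤ C * (1 / (k*h)^2) := by
          gcongr
          · exact hb k
          · exact sinc_sq_le _ (by positivity)
      _ = _ := by field_simp

lemma sumK (c : ℝ) : Summable (fun k : ℕ => c * (1 / (k:ℝ)^2)) :=
  (Real.summable_one_div_nat_pow.2 (by norm_num)).mul_left c

lemma riemann (b : ℕ → ℝ) (C s : ℝ) (hb0 : b 0 = 0) (hb : ∀ n, |b n| ≤ C)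
    (hs : Tendsto (fun n => ∑ k ∈ Finset.range n, b k) atTop (𝓝 s)) :
    Tendsto (fun h : ℝ => ∑' k : ℕ, b k * Real.sinc (k*h)^2) (𝓝[>] 0) (𝓝 s) := by
  have hr : Tendsto (fun n => s - ∑ k ∈ Finset.range (n+1), b k) atTop (𝓝 0) := by
    simpa using ((tendsto_add_atTop_iff_nat 1).2 hs).const_sub s
  have hr' : Tendsto (fun n => |s - ∑ k ∈ Finset.range (n+1), b k|) atTop (𝓝 0) := by
    simpa using hr.abs
  obtain ⟨B, hB⟩ := hr'.bddAbove_range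
  have hB' : ∀ n, |s - ∑ k ∈ Finset.range (n+1), b k| ≤ B := fun n => hB ⟨n, rfl⟩
  have hB0 : 0 ≤ B := (abs_nonneg _).trans (hB' 0)
  rw [Metric.tendsto_nhds]
  intro ε hε
  obtain ⟨K, hK⟩ := eventually_atTop.1 (hr'.eventually_lt_const (show 0 < ε / 32 by positivity))
  have hA : Tendsto (fun h : ℝ => 8 * B * Real.arctan (K*h)) (𝓝[>] 0) (𝓝 0) := by
    have : Continuous (fun h : ℝ => 8 * B * Real.arctan (K*h)) := by fun_prop
    have := (this.tendsto 0).mono_left (nhdsWithin_le_nhds (s := Set.Ioi 0))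
    simpa using this
  filter_upwards [hA.eventually_lt_const (show 0 < ε / 4 by positivity), self_mem_nhdsWithin]
    with h hh1 hh
  have hh : 0 < h := hh
  have hsum : Summable (fun k : ℕ => b k * Real.sinc (k*h)^2) :=
    Summable.of_norm_bounded (sumK _) (term_bound b C hb0 hb h hh)
  have hlim : Tendsto (fun N : ℕ => ∑ k ∈ Finset.range (N+1), b k * Real.sinc (k*h)^2
      + (s - ∑ k ∈ Finset.range (N+1), b k) * Real.sinc (N*h)^2 - s) atTop
      (𝓝 (∑' k : ℕ, b k * Real.sinc (k*h)^2 + 0 - s)) := by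
    refine ((((tendsto_add_atTop_iff_nat 1).2 hsum.hasSum.tendsto_sum_nat)).add ?_).sub_const s
    refine squeeze_zero_norm (fun N => ?_) hr'
    rw [norm_mul, Real.norm_eq_abs, Real.norm_eq_abs, abs_of_nonneg (sq_nonneg (Real.sinc _))]
    exact mul_le_of_le_one_right (abs_nonneg _) (sinc_sq_le_one _)
  have hle := le_of_tendsto' hlim.abs (b := ε / 2 + ε / 4) (fun N => by
    refine (riemann_fin b s (ε/32) B h K (by positivity) hB0 hh
      (fun n => (hB' n).trans (by linarith)) (fun n hn => (hK n hn).le) N).trans ?_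
    have p1 : Real.arctan (N*h) ≤ 2 :=
      ((Real.arctan_lt_pi_div_two _).le).trans (by linarith [Real.pi_le_four])
    have p2 : Real.arctan ((min N K : ℕ) * h) ≤ Real.arctan (K*h) := by
      rw [Real.arctan_le_arctan_iff]
      gcongr
      exact min_le_right _ _
    have p3 : 8 * B * Real.arctan ((min N K : ℕ) * h) ≤ 8 * B * Real.arctan (K*h) := by gcongr
    nlinarith)
  rw [add_zero] at hle
  rw [Real.dist_eq]
  linarith

lemma cantor_lebesgue (a : ℕ → ℝ) (ha : ∀ n, 0 ≤ a n)
    (h : ∀ x : ℝ, Tendsto (fun n : ℕ => a n * Real.sin (n*x)) atTop (𝓝 0)) :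
    ∃ C, ∀ n, a n ≤ C := by
  have hint : Tendsto (fun n : ℕ => ∫ x in (0:ℝ)..(2*Real.pi), (min 1 (a n) * Real.sin (n*x))^2) atTop
      (𝓝 (∫ x in (0:ℝ)..(2*Real.pi), (0:ℝ))) := by
    refine intervalIntegral.tendsto_integral_filter_of_dominated_convergence (fun _ => 1) ?_ ?_ ?_ ?_
    · exact Eventually.of_forall fun n => Continuous.aestronglyMeasurable (by fun_prop)
    · refine Eventually.of_forall fun n => Eventually.of_forall fun x _ => ?_
      rw [Real.norm_eq_abs, abs_of_nonneg (sq_nonneg _), sq_le_one_iff_abs_le_one, abs_mul,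
        abs_of_nonneg (le_min zero_le_one (ha n))]
      exact mul_le_one₀ (min_le_left _ _) (abs_nonneg _) (Real.abs_sin_le_one _)
    · simp
    · refine Eventually.of_forall fun x _ => ?_
      have : Tendsto (fun n : ℕ => min 1 (a n) * Real.sin (n*x)) atTop (𝓝 0) := by
        refine squeeze_zero_norm (fun n => ?_) (by simpa using (h x).abs)
        rw [Real.norm_eq_abs, abs_mul, abs_of_nonneg (le_min zero_le_one (ha n))]
        simp only [abs_of_nonneg (ha n)]
        gcongr
        exact min_le_right _ _
      simpa using this.pow 2
  have hval : ∀ n : ℕ, 1 ≤ n →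
      ∫ x in (0:ℝ)..(2*Real.pi), (min 1 (a n) * Real.sin (n*x))^2 = (min 1 (a n))^2 * Real.pi := by
    intro n hn
    have hn' : (n:ℝ) ≠ 0 := by positivity
    simp_rw [mul_pow]
    rw [intervalIntegral.integral_const_mul,
      intervalIntegral.integral_comp_mul_left (fun x => Real.sin x ^ 2) hn', integral_sin_sq]
    have : Real.sin (n * (2 * Real.pi)) = 0 := by
      rw [← mul_assoc]; exact_mod_cast Real.sin_nat_mul_pi (n*2)
    simp [this]
    field_simp
    simp
  simp only [intervalIntegral.integral_zero] at hint
  have hev : ∀ᶠ n in atTop, a n ≤ 1 := by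
    filter_upwards [hint.eventually_lt_const (show 0 < Real.pi by positivity), eventually_ge_atTop 1]
      with n h1 h2
    rw [hval n h2] at h1
    by_contra! h3
    rw [min_eq_left h3.le] at h1
    linarith
  obtain ⟨N, hN⟩ := eventually_atTop.1 hev
  refine ⟨1 + ∑ k ∈ Finset.range N, a k, fun n => ?_⟩
  have hnn := Finset.sum_nonneg (fun k (_ : k ∈ Finset.range N) => ha k)
  rcases lt_or_ge n N with hn | hn
  · have := Finset.single_le_sum (fun k _ => ha k) (Finset.mem_range.2 hn)
    linarith
  · linarith [hN n hn]

lemma tail_bound (a : ℕ → ℝ) (ha : ∀ n, 0 ≤ a n) (e : ℝ) (N : ℕ) (hN : 1 ≤ N) (he : 0 ≤ e)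
    (hA : ∀ M, N ≤ M → ∑ k ∈ Finset.range (M+1), k * a k ≤ e * M) (M : ℕ) (hM : N ≤ M) :
    ∑ k ∈ Finset.Ico (N+1) (M+1), a k * (1 / (k:ℝ)^2) ≤
      (∑ k ∈ Finset.range (M+1), k * a k) / (M:ℝ)^3 + 2 * e * (1 / (N:ℝ)^2 - 1 / (M:ℝ)^2) := by
  induction M, hM using Nat.le_induction with
  | base =>
    simp only [Finset.Ico_self, Finset.sum_empty, sub_self, mul_zero, add_zero]
    exact div_nonneg (Finset.sum_nonneg fun k _ => mul_nonneg (Nat.cast_nonneg k) (ha k)) (by positivity)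
  | succ M hM ih =>
    rw [Finset.sum_Ico_succ_top (by omega), Finset.sum_range_succ _ (M+1)]
    have hA1 := hA M hM
    set A := ∑ k ∈ Finset.range (M+1), k * a k
    have hm : (0:ℝ) < M := by exact_mod_cast (by omega : 0 < M)
    push_cast
    generalize (M:ℝ) = m at *
    have key : m * (1 / m^3 - 1 / (m+1)^3) ≤ 2 * (1 / m^2 - 1 / (m+1)^2) := by
      have : 2 * (1 / m^2 - 1 / (m+1)^2) - m * (1 / m^3 - 1 / (m+1)^3)
        = (m^2 + 3*m + 1) / (m^2 * (m+1)^3) := by field_simp; ring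
      have : 0 ≤ (m^2 + 3*m + 1) / (m^2 * (m+1)^3) := by positivity
      linarith
    have hpos : 0 ≤ 1 / m^3 - 1 / (m+1)^3 := by
      rw [sub_nonneg]; gcongr; linarith
    have h1 : A * (1 / m^3 - 1 / (m+1)^3) ≤ e * (2 * (1 / m^2 - 1 / (m+1)^2)) :=
      calc _ ≤ (e * m) * (1 / m^3 - 1 / (m+1)^3) := by gcongr
        _ = e * (m * (1 / m^3 - 1 / (m+1)^3)) := by ring
        _ ≤ _ := by gcongr
    have h2 : (A + (m+1) * a (M+1)) / (m+1)^3 = A * (1/(m+1)^3) + a (M+1) * (1 / (m+1)^2) := by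
      field_simp
    have h3 : A / m^3 = A * (1/m^3) := by ring
    rw [h2]
    rw [h3] at ih
    linarith

lemma unif_cont (f : ℝ → ℝ) (hf : Continuous f) (hper : Function.Periodic f (2 * Real.pi)) (ε : ℝ)
    (hε : 0 < ε) : ∃ δ > 0, ∀ x t, |t - x| ≤ δ → |f t - f x| ≤ ε := by
  have hu : UniformContinuousOn f (Set.Icc (-1) (2*Real.pi+1)) :=
    isCompact_Icc.uniformContinuousOn_of_continuous hf.continuousOn
  rw [Metric.uniformContinuousOn_iff] at hu
  obtain ⟨δ, hδ, H⟩ := hu ε hε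
  refine ⟨min (δ/2) 1, by positivity, fun x t hxt => ?_⟩
  obtain ⟨n, hn, -⟩ := existsUnique_add_zsmul_mem_Ico (show 0 < 2 * Real.pi by positivity) x 0
  have e1 : f (x + n • (2*Real.pi)) = f x := (hper.zsmul n) x
  have e2 : f (t + n • (2*Real.pi)) = f t := (hper.zsmul n) t
  have l1 := hxt.trans (min_le_left _ _)
  have l2 := abs_le.1 (hxt.trans (min_le_right _ _))
  rw [← e1, ← e2]
  refine (H _ ⟨?_, ?_⟩ _ ⟨?_, ?_⟩ ?_).le
  · linarith [hn.1]
  · linarith [hn.2]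
  · linarith [hn.1]
  · linarith [hn.2]
  · rw [Real.dist_eq, add_sub_add_right_eq_sub]; linarith

lemma second_diff (a : ℕ → ℝ) (C : ℝ) (ha : ∀ n, |a n| ≤ C) (h x : ℝ) (hh : 0 < h) :
    (-∑' k : ℕ, a k * Real.sin (k*(x+2*h)) * (1/(k:ℝ)^2))
     + (-∑' k : ℕ, a k * Real.sin (k*(x-2*h)) * (1/(k:ℝ)^2))
     - 2 * (-∑' k : ℕ, a k * Real.sin (k*x) * (1/(k:ℝ)^2)) =
     (2*h)^2 * ∑' k : ℕ, a k * Real.sin (k*x) * Real.sinc (k*h)^2 := by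
  have hC : 0 ≤ C := (abs_nonneg _).trans (ha 0)
  have hS : ∀ y : ℝ, HasSum (fun k : ℕ => a k * Real.sin (k*y) * (1/(k:ℝ)^2))
      (∑' k : ℕ, a k * Real.sin (k*y) * (1/(k:ℝ)^2)) := fun y => by
    refine (Summable.of_norm_bounded (sumK C) fun k => ?_).hasSum
    rw [norm_mul, norm_mul, Real.norm_eq_abs, Real.norm_eq_abs, Real.norm_eq_abs,
      abs_of_nonneg (show 0 ≤ 1/(k:ℝ)^2 by positivity)]
    gcongr
    exact (mul_le_mul (ha k) (Real.abs_sin_le_one _) (abs_nonneg _) hC).trans (by simp)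
  have h1 := ((hS (x+2*h)).neg.add (hS (x-2*h)).neg).sub ((hS x).neg.mul_left 2)
  rw [← tsum_mul_left, ← h1.tsum_eq]
  refine tsum_congr fun k => ?_
  rcases Nat.eq_zero_or_pos k with rfl | hk
  · simp
  · have hk' : (0:ℝ) < k := by exact_mod_cast hk
    rw [Real.sinc_of_ne_zero (by positivity), show (k:ℝ)*(x+2*h) = k*x+2*(k*h) by ring,
      show (k:ℝ)*(x-2*h) = k*x-2*(k*h) by ring, Real.sin_add, Real.sin_sub, Real.cos_two_mul]
    have hc : Real.cos (k*h)^2 = 1 - Real.sin (k*h)^2 := by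
      linarith [Real.sin_sq_add_cos_sq (k*h)]
    rw [hc]
    field_simp
    ring

lemma weight_lower (u : ℝ) (hu : 0 < u) (hu1 : u ≤ 1) :
    u^2 / 32 ≤ Real.sinc u ^ 2 * (1 - Real.cos u) := by
  have hpi := Real.pi_le_four
  have hpi3 := Real.pi_gt_three
  have h2 : (1:ℝ)/2 ≤ 2 / Real.pi := by
    rw [div_le_div_iff₀ (by norm_num) Real.pi_pos]; linarith
  have s1 : u / 2 ≤ Real.sin u := by
    have := Real.mul_le_sin hu.le (by linarith)
    nlinarith
  have s2 : u / 4 ≤ Real.sin (u/2) := by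
    have := Real.mul_le_sin (x := u/2) (by linarith) (by linarith)
    nlinarith
  have hc : 1 - Real.cos u = 2 * Real.sin (u/2)^2 := by
    have h1 := Real.cos_two_mul (u/2)
    have h3 := Real.sin_sq_add_cos_sq (u/2)
    rw [show 2 * (u/2) = u by ring] at h1
    linarith
  have hs : 1/2 ≤ Real.sinc u := by
    rw [Real.sinc_of_ne_zero hu.ne', le_div_iff₀ hu]; linarith
  have a1 : (1/2:ℝ)^2 ≤ Real.sinc u ^ 2 := by gcongr
  have a2 : (u/4)^2 ≤ Real.sin (u/2)^2 := by gcongr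
  rw [hc]
  have := mul_le_mul a1 a2 (by positivity) (by positivity)
  nlinarith

lemma weight_upper (u : ℝ) (hu : 0 ≤ u) (hu1 : u ≤ 1) : |1 - Real.sinc u ^ 2| ≤ u := by
  rw [abs_of_nonneg (by linarith [sinc_sq_le_one u])]
  rcases hu.eq_or_lt with rfl | hu
  · simp
  have := Real.sin_gt_sub_cube hu
  have hs : 1 - u^2/6 ≤ Real.sinc u := by
    rw [Real.sinc_of_ne_zero hu.ne', le_div_iff₀ hu]; nlinarith
  have h1 : (1 - u^2/6)^2 ≤ Real.sinc u ^ 2 := by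
    gcongr; nlinarith
  nlinarith [sq_nonneg (u^2)]

lemma int_R (a : ℕ → ℝ) (C : ℝ) (ha : ∀ n, |a n| ≤ C) (h : ℝ) (hh : 0 < h) (a0 : a 0 = 0) :
    HasSum (fun k : ℕ => a k * Real.sinc (k*h)^2 * ((1 - Real.cos (k*h)) / k))
      (∫ t in (0:ℝ)..h, ∑' k : ℕ, a k * Real.sin (k*t) * Real.sinc (k*h)^2) := by
  have hb : ∀ (k : ℕ) (t : ℝ), ‖a k * Real.sin (k*t) * Real.sinc (k*h)^2‖ ≤ C / h^2 * (1/(k:ℝ)^2) := by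
    intro k t
    refine le_trans ?_ (term_bound a C a0 ha h hh k)
    rw [norm_mul, norm_mul, norm_mul]
    gcongr
    exact mul_le_of_le_one_right (norm_nonneg _) (Real.abs_sin_le_one _)
  have := intervalIntegral.hasSum_integral_of_dominated_convergence (a := 0) (b := h)
    (μ := MeasureTheory.volume)
    (F := fun (k : ℕ) (t : ℝ) => a k * Real.sin (k*t) * Real.sinc (k*h)^2)
    (f := fun t => ∑' k : ℕ, a k * Real.sin (k*t) * Real.sinc (k*h)^2)
    (fun k _ => C / h^2 * (1/(k:ℝ)^2))
    (fun k => Continuous.aestronglyMeasurable (by fun_prop))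
    (fun k => Eventually.of_forall fun t _ => hb k t)
    (Eventually.of_forall fun t _ => sumK _)
    (by simp)
    (Eventually.of_forall fun t _ => (Summable.of_norm_bounded (sumK _) (fun k => hb k t)).hasSum)
  refine Eq.mp (congrArg (fun g => HasSum g _) (funext fun k => ?_)) this
  rw [intervalIntegral.integral_mul_const, intervalIntegral.integral_const_mul]
  rcases Nat.eq_zero_or_pos k with rfl | hk
  · simp
  · have hk' : (k:ℝ) ≠ 0 := by positivity
    rw [intervalIntegral.integral_comp_mul_left (fun x => Real.sin x) hk', integral_sin]
    simp
    ring

lemma core (a : ℕ → ℝ) (ha : ∀ n, 0 ≤ a n) (a0 : a 0 = 0) (f : ℝ → ℝ)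
    (hpt : ∀ x : ℝ, Tendsto (fun n : ℕ => ∑ k ∈ Finset.range n, a k * Real.sin (k * x)) atTop (𝓝 (f x)))
    (hf : Continuous f) (hper : Function.Periodic f (2 * Real.pi)) (ε : ℝ) (hε : 0 < ε) :
    ∃ N0, ∀ N, N0 ≤ N → ∀ x, |∑ k ∈ Finset.range (N+1), a k * Real.sin (k * x) - f x| ≤ ε := by
  obtain ⟨C, hC⟩ := cantor_lebesgue a ha (fun x => by
    have := ((tendsto_add_atTop_iff_nat 1).2 (hpt x)).sub (hpt x)
    simp only [Finset.sum_range_succ, add_sub_cancel_left, sub_self] at this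
    exact this)
  have hC' : ∀ n, |a n| ≤ C := fun n => by rw [abs_of_nonneg (ha n)]; exact hC n
  have hC0 : 0 ≤ C := (ha 0).trans (hC 0)
  set R : ℝ → ℝ → ℝ := fun h x => ∑' k : ℕ, a k * Real.sin (k*x) * Real.sinc (k*h)^2 with hR
  set F : ℝ → ℝ := fun x => -∑' k : ℕ, a k * Real.sin (k*x) * (1/(k:ℝ)^2) with hFdef
  have hbs : ∀ (x : ℝ) (k : ℕ), |a k * Real.sin (k*x)| ≤ C := fun x k => by
    rw [abs_mul]
    exact (mul_le_of_le_one_right (abs_nonneg _) (Real.abs_sin_le_one _)).trans (hC' k)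
  have hF : Continuous F := by
    refine (continuous_tsum (fun k => by fun_prop) (sumK C) fun k x => ?_).neg
    rw [norm_mul, Real.norm_eq_abs, Real.norm_eq_abs, abs_of_nonneg (show 0 ≤ 1/(k:ℝ)^2 by positivity)]
    gcongr
    exact hbs x k
  have hRF : ∀ h x : ℝ, 0 < h → F (x+2*h) + F (x-2*h) - 2 * F x = (2*h)^2 * R h x :=
    fun h x hh => second_diff a C hC' h x hh
  have hD : ∀ x, Tendsto (fun h : ℝ => (F (x+h) + F (x-h) - 2 * F x) / h^2) (𝓝[>] 0) (𝓝 (f x)) := by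
    intro x
    have h1 := riemann (fun k => a k * Real.sin (k*x)) C (f x) (by simp) (hbs x) (hpt x)
    have h2 : Tendsto (fun h : ℝ => h / 2) (𝓝[>] 0) (𝓝[>] 0) := by
      refine tendsto_nhdsWithin_iff.2 ⟨?_, ?_⟩
      · have : Continuous (fun h : ℝ => h / 2) := by fun_prop
        simpa using (this.tendsto 0).mono_left (nhdsWithin_le_nhds (s := Set.Ioi 0))
      · filter_upwards [self_mem_nhdsWithin] with h hh
        have : 0 < h := hh
        exact half_pos this
    refine (h1.comp h2).congr' ?_
    filter_upwards [self_mem_nhdsWithin] with h hh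
    have hh : 0 < h := hh
    have := hRF (h/2) x (half_pos hh)
    rw [show 2 * (h/2) = h by ring] at this
    rw [this]
    rw [mul_div_cancel_left₀ _ (by positivity)]
    rfl
  have hC3 : ∀ e > 0, ∃ δ > 0, ∀ h, 0 < h → h ≤ δ → ∀ x, |R h x - f x| ≤ e := by
    intro e he
    obtain ⟨δ, hδ, H⟩ := unif_cont f hf hper e he
    refine ⟨δ/2, by positivity, fun h hh hhd x => ?_⟩
    have h1 := schwarz_abs F f hF hD x (2*h) e (by positivity)
      (fun t ht => H x t (ht.trans (by linarith)))
    rw [hRF h x hh, show (2*h)^2 * R h x - f x * (2*h)^2 = (R h x - f x) * (2*h)^2 by ring, abs_mul,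
      abs_of_pos (show 0 < (2*h)^2 by positivity)] at h1
    exact le_of_mul_le_mul_right h1 (by positivity)
  have f0 : f 0 = 0 := by
    have := hpt 0
    simp only [mul_zero, Real.sin_zero, Finset.sum_const_zero] at this
    exact tendsto_nhds_unique this tendsto_const_nhds
  have hE : ∀ e > 0, ∃ N0 : ℕ, 1 ≤ N0 ∧ ∀ N, N0 ≤ N → ∑ k ∈ Finset.range (N+1), k * a k ≤ e * N := by
    intro e he
    obtain ⟨δ1, hδ1, H1⟩ := hC3 (e/64) (by positivity)
    obtain ⟨δ2, hδ2, H2⟩ := unif_cont f hf hper (e/64) (by positivity)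
    obtain ⟨N0, hN0⟩ := exists_nat_gt (1 / min δ1 δ2)
    have hmin : 0 < min δ1 δ2 := lt_min hδ1 hδ2
    have hN0' : (0:ℝ) < N0 := lt_trans (by positivity) hN0
    refine ⟨N0, by exact_mod_cast hN0', fun N hN => ?_⟩
    have hNr : (N0:ℝ) ≤ N := by exact_mod_cast hN
    have hN' : (0:ℝ) < N := lt_of_lt_of_le hN0' hNr
    set h : ℝ := 1 / N with hh
    have hpos : 0 < h := by positivity
    have hle : h ≤ min δ1 δ2 := by
      rw [hh, div_le_iff₀ hN']
      rw [div_lt_iff₀ hmin] at hN0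
      nlinarith
    have hS := int_R a C hC' h hpos a0
    have hI : ∫ t in (0:ℝ)..h, R h t ≤ e / 32 * h := by
      have := intervalIntegral.norm_integral_le_of_norm_le_const (a := 0) (b := h) (f := R h)
        (C := e/32) (fun t ht => by
          rw [Set.uIoc_of_le hpos.le] at ht
          have b1 := abs_le.1 (H1 h hpos (hle.trans (min_le_left _ _)) t)
          have b2 := abs_le.1 (H2 0 t (by
            rw [sub_zero, abs_of_pos ht.1]; exact ht.2.trans (hle.trans (min_le_right _ _))))
          rw [f0] at b2
          rw [Real.norm_eq_abs, abs_le]; constructor <;> linarith)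
      rw [sub_zero, abs_of_pos hpos] at this
      exact (le_abs_self _).trans this
    have hpart := sum_le_hasSum (Finset.range (N+1)) (fun k _ =>
      mul_nonneg (mul_nonneg (ha k) (sq_nonneg _))
        (div_nonneg (by linarith [Real.cos_le_one (k*h)]) (Nat.cast_nonneg k))) hS
    have hlow : ∑ k ∈ Finset.range (N+1), (k * a k) * (h^2/32) ≤
        ∑ k ∈ Finset.range (N+1), a k * Real.sinc (k*h)^2 * ((1 - Real.cos (k*h)) / k) := by
      refine Finset.sum_le_sum fun k hk => ?_
      rcases Nat.eq_zero_or_pos k with rfl | hk0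
      · simp
      have hk' : (0:ℝ) < k := by exact_mod_cast hk0
      have hkN : (k:ℝ) ≤ N := by exact_mod_cast Nat.lt_succ_iff.1 (Finset.mem_range.1 hk)
      have w := weight_lower (k*h) (by positivity) (by
        rw [hh, mul_one_div, div_le_one hN']; exact hkN)
      calc (k * a k) * (h^2/32) = a k / k * ((k*h)^2/32) := by field_simp
        _ ≤ a k / k * (Real.sinc (k*h) ^ 2 * (1 - Real.cos (k*h))) :=
          mul_le_mul_of_nonneg_left w (div_nonneg (ha k) hk'.le)
        _ = _ := by ring
    rw [← Finset.sum_mul] at hlow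
    have := (hlow.trans hpart).trans hI
    have hNh : N * h = 1 := by rw [hh]; field_simp
    have h3 : (∑ k ∈ Finset.range (N+1), k * a k) * h^2 ≤ (e * N) * h^2 := by
      calc _ ≤ e * h := by linarith
        _ = e * h * (N * h) := by rw [hNh, mul_one]
        _ = _ := by ring
    exact le_of_mul_le_mul_right h3 (by positivity)
  -- final
  obtain ⟨δ, hδ, H1⟩ := hC3 (ε/2) (by positivity)
  obtain ⟨N1, hN1, H2⟩ := hE (ε/8) (by positivity)
  obtain ⟨N2, hN2⟩ := exists_nat_gt (1 / δ)
  refine ⟨max N1 N2, fun N hN x => ?_⟩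
  have hNN1 : N1 ≤ N := (le_max_left _ _).trans hN
  have hNN2 : (N2:ℝ) ≤ N := by exact_mod_cast (le_max_right _ _).trans hN
  have hN' : (0:ℝ) < N := by exact_mod_cast (by omega : 0 < N)
  set h : ℝ := 1 / N with hh
  have hpos : 0 < h := by positivity
  have hle : h ≤ δ := by
    rw [hh, div_le_iff₀ hN']
    rw [div_lt_iff₀ hδ] at hN2
    nlinarith
  have hNh : N * h = 1 := by rw [hh]; field_simp
  have b1 := H1 h hpos hle x
  have hA := H2 N hNN1
  suffices hs : |∑ k ∈ Finset.range (N+1), a k * Real.sin (k * x) - R h x| ≤ ε/2 by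
    have := abs_add_le (∑ k ∈ Finset.range (N+1), a k * Real.sin (k * x) - R h x) (R h x - f x)
    rw [sub_add_sub_cancel] at this
    linarith
  have hsum : Summable (fun k : ℕ => a k * Real.sin (k*x) * Real.sinc (k*h)^2) :=
    Summable.of_norm_bounded (sumK _)
      (term_bound (fun k => a k * Real.sin (k*x)) C (by simp) (hbs x) h hpos)
  have hlim := ((((tendsto_add_atTop_iff_nat 1).2 hsum.hasSum.tendsto_sum_nat)).const_sub
    (∑ k ∈ Finset.range (N+1), a k * Real.sin (k * x))).abs
  refine le_of_tendsto hlim ?_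
  filter_upwards [eventually_ge_atTop N] with M hM
  have hM' : (0:ℝ) < M := lt_of_lt_of_le hN' (by exact_mod_cast hM)
  have hMN : (N:ℝ) ≤ M := by exact_mod_cast hM
  rw [← Finset.sum_range_add_sum_Ico _ (show N+1 ≤ M+1 by omega), ← sub_sub, ← Finset.sum_sub_distrib]
  have t1 : |∑ k ∈ Finset.range (N+1), (a k * Real.sin (k * x) - a k * Real.sin (k*x) * Real.sinc (k*h)^2)|
      ≤ ε / 8 := by
    calc _ ≤ ∑ k ∈ Finset.range (N+1), (k * a k) * h := by
          refine (Finset.abs_sum_le_sum_abs _ _).trans (Finset.sum_le_sum fun k hk => ?_)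
          have hkN : (k:ℝ) ≤ N := by exact_mod_cast Nat.lt_succ_iff.1 (Finset.mem_range.1 hk)
          have w := weight_upper (k*h) (by positivity) (by
            rw [hh, mul_one_div, div_le_one hN']; exact hkN)
          rw [← mul_one_sub, abs_mul, abs_mul, abs_of_nonneg (ha k)]
          calc a k * |Real.sin (k*x)| * |1 - Real.sinc (k*h)^2| ≤ a k * 1 * (k*h) := by
                have := ha k
                gcongr
                exact Real.abs_sin_le_one _
            _ = _ := by ring
      _ ≤ (ε / 8 * N) * h := by rw [← Finset.sum_mul]; gcongr
      _ = ε / 8 := by rw [mul_assoc, hNh, mul_one]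
  have t2 : |∑ k ∈ Finset.Ico (N+1) (M+1), a k * Real.sin (k*x) * Real.sinc (k*h)^2| ≤ 3 * ε / 8 := by
    have tb := tail_bound a ha (ε/8) N (by omega) (by positivity)
      (fun M hM => H2 M (hNN1.trans hM)) M hM
    have tb2 : (∑ k ∈ Finset.range (M+1), k * a k) / (M:ℝ)^3 ≤ ε/8 * (1/(M:ℝ)^2) := by
      calc _ ≤ (ε/8 * M) / (M:ℝ)^3 := by gcongr; exact H2 M (hNN1.trans hM)
        _ = _ := by field_simp
    have tb3 : 1/(M:ℝ)^2 ≤ 1/(N:ℝ)^2 := by gcongr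
    have tb4 : 0 < 1/(M:ℝ)^2 := by positivity
    have tb5 : ∑ k ∈ Finset.Ico (N+1) (M+1), a k * (1 / (k:ℝ)^2) ≤ 3 * ε / 8 * (1/(N:ℝ)^2) := by
      nlinarith
    calc _ ≤ ∑ k ∈ Finset.Ico (N+1) (M+1), (a k * (1 / (k:ℝ)^2)) * (N:ℝ)^2 := by
          refine (Finset.abs_sum_le_sum_abs _ _).trans (Finset.sum_le_sum fun k hk => ?_)
          have hk0 : 0 < k := by have := (Finset.mem_Ico.1 hk).1; omega
          have hk' : (0:ℝ) < k := by exact_mod_cast hk0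
          rw [abs_mul, abs_mul, abs_of_nonneg (ha k), abs_of_nonneg (sq_nonneg (Real.sinc _))]
          calc a k * |Real.sin (k*x)| * Real.sinc (k*h)^2 ≤ a k * 1 * (1/(k*h)^2) := by
                have := ha k
                gcongr
                · exact Real.abs_sin_le_one _
                · exact sinc_sq_le _ (by positivity)
            _ = _ := by rw [hh]; field_simp
      _ ≤ (3 * ε / 8 * (1/(N:ℝ)^2)) * (N:ℝ)^2 := by rw [← Finset.sum_mul]; gcongr
      _ = 3 * ε / 8 := by field_simp
  refine (abs_sub _ _).trans ?_
  linarith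

/-- If a sine series with nonnegative coefficients converges pointwise to a
continuous 2π-periodic function `f`, then its partial sums converge to `f`
uniformly on ℝ. -/
theorem stmt8 (a : ℕ → ℝ) (ha : ∀ n : ℕ, 1 ≤ n → 0 ≤ a n) (f : ℝ → ℝ)
    (hpt : ∀ x : ℝ,
      Tendsto (fun n : ℕ => ∑ k ∈ Finset.Icc 1 n, a k * Real.sin (k * x))
        atTop (nhds (f x)))
    (hf : Continuous f) (hper : Function.Periodic f (2 * Real.pi)) :
    TendstoUniformly
      (fun (n : ℕ) (x : ℝ) => ∑ k ∈ Finset.Icc 1 n, a k * Real.sin (k * x))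
      f atTop := by
  have key : ∀ (n : ℕ) (x : ℝ), ∑ k ∈ Finset.Icc 1 n, a k * Real.sin (k * x) =
      ∑ k ∈ Finset.range (n+1), (if k = 0 then 0 else a k) * Real.sin (k * x) := by
    intro n x
    induction n with
    | zero => simp
    | succ n ih =>
      rw [Finset.sum_Icc_succ_top (by omega), ih, Finset.sum_range_succ _ (n+1)]
      simp
  simp only [key] at hpt ⊢
  have H := core (fun k => if k = 0 then 0 else a k)
    (fun n => by
      rcases Nat.eq_zero_or_pos n with rfl | hn
      · simp
      · simp [hn.ne', ha n hn]) (by simp) f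
    (fun x => (tendsto_add_atTop_iff_nat 1).1 (hpt x)) hf hper
  rw [Metric.tendstoUniformly_iff]
  intro ε hε
  obtain ⟨N0, h0⟩ := H (ε/2) (by positivity)
  filter_upwards [eventually_ge_atTop N0] with N hN x
  rw [dist_comm, Real.dist_eq]
  exact (h0 N hN x).trans_lt (by linarith)
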